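/- arXiv:2312.09144 — 3 statements merged into one kernel-verified Lean document; each statement's English description precedes it below -/
import Mathlib

section
/- Let V be a finite-dimensional ℤ₂-vector space with basis q₁,…,qₙ, positive heights h(qᵢ), filtration V^t = span{qᵢ : h(qᵢ) ≤ t}, and a filtration-preserving linear differential ∂ with ∂² = 0. Fix δ > 0 and let S = V ⊕ ℤ₂⟨e, f⟩ be the vector space obtained by adjoining two new basis vectors e and f, with heights satisfying 0 < h(e) − h(f) < 2δ, filtration S^t spanned by all basis vectors of height ≤ t, and differential ∂_S extending ∂ by ∂_S(e) = f and ∂_S(f) = 0 (so ∂_S² = 0 and ∂_S is filtration-preserving). Define, for each t, the chain maps ιᵗ : V^t → S^{t+δ} given by inclusion followed by transfer, and rᵗ : S^t → V^{t+δ} given by the projection killing e and f followed by transfer. Then the induced maps on homology H(ιᵗ) and H(rᵗ) form a 2δ-interleaving of the persistence modules {H(V^t, ∂)}_{t∈ℝ} and {H(S^t, ∂_S)}_{t∈ℝ}: both families commute with the induced transfer maps, H(r^{t+δ})∘H(ιᵗ) equals the map on homology induced by the inclusion V^t ↪ V^{t+2δ}, and H(ι^{t+δ})∘H(rᵗ)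 equals the map on homology induced by the inclusion S^t ↪ S^{t+2δ}. -/
set_option synthInstance.maxHeartbeats 1000000
set_option maxHeartbeats 4000000

/-- The homology of a ℤ₂-linear endomorphism `d`: `ker d / im d`
(implemented as the quotient of `ker d` by the pullback of `range d`). -/
abbrev Hmlgy {M : Type*} [AddCommGroup M] [Module (ZMod 2) M]
    (d : M →ₗ[ZMod 2] M) : Type _ :=
  ↥(LinearMap.ker d) ⧸
    (Submodule.comap (LinearMap.ker d).subtype (LinearMap.range d))

/-- The map induced on homology by a chain map `f` intertwining `d` and `d'`. -/
def inducedMap {M N : Type*} [AddCommGroup M] [Module (ZMod 2) M]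
    [AddCommGroup N] [Module (ZMod 2) N]
    (d : M →ₗ[ZMod 2] M) (d' : N →ₗ[ZMod 2] N) (f : M →ₗ[ZMod 2] N)
    (hf : f ∘ₗ d = d' ∘ₗ f) :
    Hmlgy d →ₗ[ZMod 2] Hmlgy d' :=
  Submodule.mapQ _ _
    (f.restrict (p := LinearMap.ker d) (q := LinearMap.ker d')
      (fun x hx => by
        have h1 := LinearMap.congr_fun hf x
        simp only [LinearMap.comp_apply] at h1
        have hx' : d x = 0 := hx
        simp [LinearMap.mem_ker, ← h1, hx']))
    (by
      intro x hx
      have hx' : (x : M) ∈ LinearMap.range d := hx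
      obtain ⟨y, hy⟩ := hx'
      have h1 := LinearMap.congr_fun hf y
      simp only [LinearMap.comp_apply] at h1
      have : f (x : M) ∈ LinearMap.range d' := ⟨f y, by rw [← h1, hy]⟩
      exact this)

theorem inducedMap_comp {L M N : Type*} [AddCommGroup L] [Module (ZMod 2) L]
    [AddCommGroup M] [Module (ZMod 2) M] [AddCommGroup N] [Module (ZMod 2) N]
    {dL : L →ₗ[ZMod 2] L} {dM : M →ₗ[ZMod 2] M} {dN : N →ₗ[ZMod 2] N}
    {f : L →ₗ[ZMod 2] M} {g : M →ₗ[ZMod 2] N}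
    (hf : f ∘ₗ dL = dM ∘ₗ f) (hg : g ∘ₗ dM = dN ∘ₗ g)
    (hgf : (g ∘ₗ f) ∘ₗ dL = dN ∘ₗ (g ∘ₗ f)) :
    inducedMap dM dN g hg ∘ₗ inducedMap dL dM f hf = inducedMap dL dN (g ∘ₗ f) hgf := by
  ext x
  rfl

/-- Chain maps whose difference sends cycles to boundaries induce the same map on homology. -/
theorem inducedMap_eq_of_sub_mem_range {M N : Type*} [AddCommGroup M] [Module (ZMod 2) M]
    [AddCommGroup N] [Module (ZMod 2) N]
    {d : M →ₗ[ZMod 2] M} {d' : N →ₗ[ZMod 2] N} {f g : M →ₗ[ZMod 2] N}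
    (hf : f ∘ₗ d = d' ∘ₗ f) (hg : g ∘ₗ d = d' ∘ₗ g)
    (hfg : ∀ x, d x = 0 → f x - g x ∈ LinearMap.range d') :
    inducedMap d d' f hf = inducedMap d d' g hg := by
  ext x
  exact (Submodule.Quotient.eq _).2 (hfg x x.2)

theorem inducedMap_comp_eq_of_sub_mem_range {L M N : Type*} [AddCommGroup L] [Module (ZMod 2) L]
    [AddCommGroup M] [Module (ZMod 2) M] [AddCommGroup N] [Module (ZMod 2) N]
    {dL : L →ₗ[ZMod 2] L} {dM : M →ₗ[ZMod 2] M} {dN : N →ₗ[ZMod 2] N}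
    {f : L →ₗ[ZMod 2] M} {g : M →ₗ[ZMod 2] N} {k : L →ₗ[ZMod 2] N}
    (hf : f ∘ₗ dL = dM ∘ₗ f) (hg : g ∘ₗ dM = dN ∘ₗ g) (hk : k ∘ₗ dL = dN ∘ₗ k)
    (hgfk : ∀ x, dL x = 0 → g (f x) - k x ∈ LinearMap.range dN) :
    inducedMap dM dN g hg ∘ₗ inducedMap dL dM f hf = inducedMap dL dN k hk := by
  have hgf : (g ∘ₗ f) ∘ₗ dL = dN ∘ₗ (g ∘ₗ f) := by
    rw [LinearMap.comp_assoc, hf, ← LinearMap.comp_assoc, hg, LinearMap.comp_assoc]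
  rw [inducedMap_comp hf hg hgf]
  exact inducedMap_eq_of_sub_mem_range hgf hk hgfk

theorem inducedMap_comp_eq_comp {L M M' N : Type*} [AddCommGroup L] [Module (ZMod 2) L]
    [AddCommGroup M] [Module (ZMod 2) M] [AddCommGroup M'] [Module (ZMod 2) M']
    [AddCommGroup N] [Module (ZMod 2) N]
    {dL : L →ₗ[ZMod 2] L} {dM : M →ₗ[ZMod 2] M} {dM' : M' →ₗ[ZMod 2] M'}
    {dN : N →ₗ[ZMod 2] N}
    {f : L →ₗ[ZMod 2] M} {g : M →ₗ[ZMod 2] N} {f' : L →ₗ[ZMod 2] M'} {g' : M' →ₗ[ZMod 2] N}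
    (hf : f ∘ₗ dL = dM ∘ₗ f) (hg : g ∘ₗ dM = dN ∘ₗ g)
    (hf' : f' ∘ₗ dL = dM' ∘ₗ f') (hg' : g' ∘ₗ dM' = dN ∘ₗ g')
    (hcomm : ∀ x, g (f x) = g' (f' x)) :
    inducedMap dM dN g hg ∘ₗ inducedMap dL dM f hf =
      inducedMap dM' dN g' hg' ∘ₗ inducedMap dL dM' f' hf' := by
  have hgf' : (g' ∘ₗ f') ∘ₗ dL = dN ∘ₗ (g' ∘ₗ f') := by
    rw [LinearMap.comp_assoc, hf', ← LinearMap.comp_assoc, hg', LinearMap.comp_assoc]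
  rw [inducedMap_comp hf' hg' hgf']
  refine inducedMap_comp_eq_of_sub_mem_range hf hg hgf' fun x _ => ?_
  simp [hcomm x]

/-- Stabilizing a filtered chain complex by adjoining two
generators `e, f` with `∂e = f` and `0 < h(e) − h(f) < 2δ` changes the
persistent homology only up to a 2δ-interleaving, witnessed by the
inclusion/projection maps `ι` and `r`. -/
theorem stmt_4 (n : ℕ) (h : Fin n → ℝ) (hpos : ∀ i, 0 < h i)
    (d : (Fin n → ZMod 2) →ₗ[ZMod 2] (Fin n → ZMod 2))
    (hd2 : d ∘ₗ d = 0)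
    (Vf : ℝ → Submodule (ZMod 2) (Fin n → ZMod 2))
    (hVf : ∀ t, Vf t = Submodule.span (ZMod 2) {w | ∃ i, h i ≤ t ∧ w = Pi.single i 1})
    (hdfilt : ∀ t, ∀ x ∈ Vf t, d x ∈ Vf t)
    (δ he hf : ℝ) (hδ : 0 < δ) (hhf : 0 < hf)
    (hef₁ : 0 < he - hf) (hef₂ : he - hf < 2 * δ)
    -- the stabilized complex S = V ⊕ ℤ₂⟨e, f⟩, with e = (0,(1,0)), f = (0,(0,1))
    (dS : ((Fin n → ZMod 2) × (ZMod 2 × ZMod 2)) →ₗ[ZMod 2]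
        ((Fin n → ZMod 2) × (ZMod 2 × ZMod 2)))
    (hdS : ∀ p : (Fin n → ZMod 2) × (ZMod 2 × ZMod 2), dS p = (d p.1, (0, p.2.1)))
    (Sf : ℝ → Submodule (ZMod 2) ((Fin n → ZMod 2) × (ZMod 2 × ZMod 2)))
    (hSf : ∀ t, Sf t = Submodule.span (ZMod 2)
        ({w | ∃ i, h i ≤ t ∧ w = ((Pi.single i 1 : Fin n → ZMod 2), ((0 : ZMod 2), (0 : ZMod 2)))}
          ∪ {w | he ≤ t ∧ w = ((0 : Fin n → ZMod 2), ((1 : ZMod 2), (0 : ZMod 2)))}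
          ∪ {w | hf ≤ t ∧ w = ((0 : Fin n → ZMod 2), ((0 : ZMod 2), (1 : ZMod 2)))}))
    (hdSfilt : ∀ t, ∀ x ∈ Sf t, dS x ∈ Sf t)
    (hVmono : ∀ s t, s ≤ t → Vf s ≤ Vf t)
    (hSmono : ∀ s t, s ≤ t → Sf s ≤ Sf t)
    -- the chain transfer maps are the inclusions
    (hVtr : ∀ s t (hst : s ≤ t),
      Submodule.inclusion (hVmono s t hst) ∘ₗ d.restrict (hdfilt s) =
        d.restrict (hdfilt t) ∘ₗ Submodule.inclusion (hVmono s t hst))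
    (hStr : ∀ s t (hst : s ≤ t),
      Submodule.inclusion (hSmono s t hst) ∘ₗ dS.restrict (hdSfilt s) =
        dS.restrict (hdSfilt t) ∘ₗ Submodule.inclusion (hSmono s t hst))
    -- ιᵗ : V^t → S^{t+δ} is inclusion followed by transfer
    (ι : ∀ t : ℝ, (Vf t) →ₗ[ZMod 2] (Sf (t + δ)))
    (hι : ∀ t (x : Vf t),
      (ι t x : (Fin n → ZMod 2) × (ZMod 2 × ZMod 2)) =
        ((x : Fin n → ZMod 2), ((0 : ZMod 2), (0 : ZMod 2))))
    -- rᵗ : S^t → V^{t+δ} is the projection killing e and f, followed by transfer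
    (r : ∀ t : ℝ, (Sf t) →ₗ[ZMod 2] (Vf (t + δ)))
    (hr : ∀ t (x : Sf t),
      ((r t x : Fin n → ZMod 2)) = (x : (Fin n → ZMod 2) × (ZMod 2 × ZMod 2)).1)
    -- ι and r are chain maps
    (hιchain : ∀ t, ι t ∘ₗ d.restrict (hdfilt t) = dS.restrict (hdSfilt (t + δ)) ∘ₗ ι t)
    (hrchain : ∀ t, r t ∘ₗ dS.restrict (hdSfilt t) = d.restrict (hdfilt (t + δ)) ∘ₗ r t) :
    -- the induced maps on homology commute with the induced transfer maps
    (∀ s t (hst : s ≤ t),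
      inducedMap (d.restrict (hdfilt t)) (dS.restrict (hdSfilt (t + δ))) (ι t) (hιchain t) ∘ₗ
          inducedMap (d.restrict (hdfilt s)) (d.restrict (hdfilt t))
            (Submodule.inclusion (hVmono s t hst)) (hVtr s t hst) =
        inducedMap (dS.restrict (hdSfilt (s + δ))) (dS.restrict (hdSfilt (t + δ)))
            (Submodule.inclusion (hSmono (s + δ) (t + δ) (by linarith)))
            (hStr (s + δ) (t + δ) (by linarith)) ∘ₗ
          inducedMap (d.restrict (hdfilt s)) (dS.restrict (hdSfilt (s + δ))) (ι s) (hιchain s)) ∧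
    (∀ s t (hst : s ≤ t),
      inducedMap (dS.restrict (hdSfilt t)) (d.restrict (hdfilt (t + δ))) (r t) (hrchain t) ∘ₗ
          inducedMap (dS.restrict (hdSfilt s)) (dS.restrict (hdSfilt t))
            (Submodule.inclusion (hSmono s t hst)) (hStr s t hst) =
        inducedMap (d.restrict (hdfilt (s + δ))) (d.restrict (hdfilt (t + δ)))
            (Submodule.inclusion (hVmono (s + δ) (t + δ) (by linarith)))
            (hVtr (s + δ) (t + δ) (by linarith)) ∘ₗ
          inducedMap (dS.restrict (hdSfilt s)) (d.restrict (hdfilt (s + δ))) (r s) (hrchain s)) ∧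
    -- H(r^{t+δ}) ∘ H(ιᵗ) is induced by the inclusion V^t ↪ V^{t+2δ}
    (∀ t, inducedMap (dS.restrict (hdSfilt (t + δ))) (d.restrict (hdfilt (t + δ + δ)))
          (r (t + δ)) (hrchain (t + δ)) ∘ₗ
        inducedMap (d.restrict (hdfilt t)) (dS.restrict (hdSfilt (t + δ))) (ι t) (hιchain t) =
      inducedMap (d.restrict (hdfilt t)) (d.restrict (hdfilt (t + δ + δ)))
        (Submodule.inclusion (hVmono t (t + δ + δ) (by linarith)))
        (hVtr t (t + δ + δ) (by linarith))) ∧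
    -- H(ι^{t+δ}) ∘ H(rᵗ) is induced by the inclusion S^t ↪ S^{t+2δ}
    (∀ t, inducedMap (d.restrict (hdfilt (t + δ))) (dS.restrict (hdSfilt (t + δ + δ)))
          (ι (t + δ)) (hιchain (t + δ)) ∘ₗ
        inducedMap (dS.restrict (hdSfilt t)) (d.restrict (hdfilt (t + δ))) (r t) (hrchain t) =
      inducedMap (dS.restrict (hdSfilt t)) (dS.restrict (hdSfilt (t + δ + δ)))
        (Submodule.inclusion (hSmono t (t + δ + δ) (by linarith)))
        (hStr t (t + δ + δ) (by linarith))) := by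
  refine ⟨fun s t hst => ?_, fun s t hst => ?_, fun t => ?_, fun t => ?_⟩
  · refine inducedMap_comp_eq_comp _ _ _ _ fun x => Subtype.ext ?_
    simp [hι]
  · refine inducedMap_comp_eq_comp _ _ _ _ fun x => Subtype.ext ?_
    simp [hr]
  · refine inducedMap_comp_eq_of_sub_mem_range _ _ _ fun x _ => ?_
    have hx : r (t + δ) (ι t x) = Submodule.inclusion (hVmono t (t + δ + δ) (by linarith)) x :=
      Subtype.ext (by simp [hr, hι])
    simp [hx]
  · refine inducedMap_comp_eq_of_sub_mem_range _ _ _ fun x hx => ?_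
    have hdx : dS x = 0 := congrArg Subtype.val hx
    rw [hdS] at hdx
    have he_zero : (x : (Fin n → ZMod 2) × (ZMod 2 × ZMod 2)).2.1 = 0 :=
      congrArg (fun p => p.2.2) hdx
    have hf_level : ∀ y ∈ Sf t, y.2.2 = 0 ∨ hf ≤ t := by
      intro y hy
      by_cases hft : hf ≤ t
      · exact Or.inr hft
      refine Or.inl ?_
      rw [hSf] at hy
      induction hy using Submodule.span_induction with
      | mem w hw =>
        rcases hw with (⟨i, -, rfl⟩ | ⟨-, rfl⟩) | ⟨hft', -⟩
        · rfl
        · rfl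
        · exact absurd hft' hft
      | zero => rfl
      | add a b _ _ ha hb => simp [ha, hb]
      | smul c a _ ha => simp [ha]
    have hprim : ((0 : Fin n → ZMod 2), (-(x : (Fin n → ZMod 2) × (ZMod 2 × ZMod 2)).2.2,
        (0 : ZMod 2))) ∈ Sf (t + δ + δ) := by
      rcases hf_level x x.2 with h0 | hft
      · rw [h0, neg_zero]
        exact Submodule.zero_mem _
      · have hmem : ((0 : Fin n → ZMod 2), ((1 : ZMod 2), (0 : ZMod 2))) ∈ Sf (t + δ + δ) := by
          rw [hSf]
          exact Submodule.subset_span (Or.inl (Or.inr ⟨by linarith, rfl⟩))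
        simpa using Submodule.smul_mem _
          (-(x : (Fin n → ZMod 2) × (ZMod 2 × ZMod 2)).2.2) hmem
    refine ⟨⟨_, hprim⟩, Subtype.ext ?_⟩
    ext <;> simp [hdS, hι, hr, he_zero]
end

section
/- Let α : Fin m → Fin n → ℤ be a coefficient matrix (row i encodes the inequality ∑_j α(i,j)·h_j > 0). Run the flooding algorithm: set R'₀ = Fin m; recursively, T_k = { j ∈ Fin n : j ∉ T₁ ∪ ⋯ ∪ T_{k−1} and α(i,j) ≥ 0 for all i ∈ R'_{k−1} }, and R'_k = R'_{k−1} \ { i : α(i,j) > 0 for some j ∈ T_k }. Suppose the algorithm succeeds, i.e., there is a K with R'_K = ∅ and every j ∈ Fin n lies in some tier T₁,…,T_K (with leftover variables placed in a final tier). Then for every inequality index i ∈ Fin m there exists j with α(i,j) > 0 such that for every j' with α(i,j') < 0, the tier index of j' is strictly greater than the tier index of j. -/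
/-- If the flooding algorithm succeeds on the system of
inequalities encoded by `α` (tiers `T 1, T 2, …`, remaining inequalities
`R' 0 ⊇ R' 1 ⊇ …`, every variable assigned a tier index), then every
inequality has a variable with positive coefficient whose tier index is
strictly smaller than the tier index of every variable appearing with
negative coefficient. -/
theorem stmt_5 (m n : ℕ) (α : Fin m → Fin n → ℤ)
    (T : ℕ → Finset (Fin n)) (R' : ℕ → Finset (Fin m))
    (hR0 : R' 0 = Finset.univ)
    -- T (k+1) consists of the unassigned variables with nonnegative
    -- coefficient in every remaining inequality
    (hT : ∀ k : ℕ, ∀ j : Fin n, j ∈ T (k + 1) ↔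
      ((∀ l, 1 ≤ l → l ≤ k → j ∉ T l) ∧ ∀ i ∈ R' k, 0 ≤ α i j))
    -- remove the inequalities in which some tier-(k+1) variable has a
    -- positive coefficient
    (hR : ∀ k : ℕ, ∀ i : Fin m, i ∈ R' (k + 1) ↔
      (i ∈ R' k ∧ ¬∃ j ∈ T (k + 1), 0 < α i j))
    -- the algorithm succeeds: after K steps no inequalities remain
    (K : ℕ) (hK : R' K = ∅)
    -- each variable receives a tier index: its tier if it was assigned to
    -- one of T 1, …, T K, and K+1 (the final leftover tier) otherwise
    (tierIdx : Fin n → ℕ)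
    (htier : ∀ j : Fin n,
      (∃ k, 1 ≤ k ∧ k ≤ K ∧ j ∈ T k ∧ tierIdx j = k) ∨
      ((∀ k, 1 ≤ k → k ≤ K → j ∉ T k) ∧ tierIdx j = K + 1)) :
    ∀ i : Fin m, ∃ j : Fin n, 0 < α i j ∧
      ∀ j' : Fin n, α i j' < 0 → tierIdx j < tierIdx j' := by
  intro i
  have hanti : Antitone R' := antitone_nat_of_succ_le fun k x hx => ((hR k x).1 hx).1
  obtain ⟨k, hkK, hik, hik'⟩ : ∃ k < K, i ∈ R' k ∧ i ∉ R' (k + 1) := by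
    by_contra! h
    have hmem : ∀ k ≤ K, i ∈ R' k := by
      intro k
      induction k with
      | zero => simp [hR0]
      | succ k ih => exact fun hk => h k hk (ih (Nat.le_of_succ_le hk))
    simpa [hK] using hmem K le_rfl
  obtain ⟨j, hj, hpos⟩ : ∃ j ∈ T (k + 1), 0 < α i j := by
    by_contra h
    exact hik' ((hR k i).2 ⟨hik, h⟩)
  have hidx : tierIdx j ≤ k + 1 := by
    rcases htier j with ⟨l, hl, -, hjl, hl'⟩ | ⟨hno, -⟩
    · by_contra! hlt
      obtain ⟨p, rfl⟩ := Nat.exists_eq_add_of_le' hl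
      exact ((hT p j).1 hjl).1 (k + 1) (by omega) (by omega) hj
    · exact absurd hj (hno (k + 1) (by omega) hkK)
  refine ⟨j, hpos, fun j' hneg => hidx.trans_lt ?_⟩
  rcases htier j' with ⟨l, hl, -, hjl, hl'⟩ | ⟨-, hl'⟩
  · by_contra! hle
    obtain ⟨p, rfl⟩ := Nat.exists_eq_add_of_le' hl
    have hp : p ≤ k := by omega
    exact absurd (((hT p j').1 hjl).2 i (hanti hp hik)) (not_le.2 hneg)
  · omega
end

section
/- Let α : Fin m → Fin n → ℤ satisfy |α(i,j)| ≤ 2 for all i, j. Let τ : Fin n → {1,…,M} be an assignment of each variable to a tier, and suppose that for every i ∈ Fin m there exists j with α(i,j) > 0 such that τ(j') > τ(j) for every j' with α(i,j') < 0. Define positive integers h_1,…,h_M by downward recursion: h_M = 1 and h_k = 1 + ∑_{ℓ=k+1}^{M} 2·h_ℓ·|T_ℓ| for k = M−1, …, 1, where |T_ℓ| = #{ j ∈ Fin n : τ(j) = ℓ }. Then the height assignment giving each variable j the value h_{τ(j)} satisfies every inequality: for all i ∈ Fin m, ∑_{j} α(i,j)·h_{τ(j)} > 0. -/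
/-- Summing a function of the tier over the tiers above `k`, weighted by their sizes, is summing
over the variables whose tier exceeds `k`. -/
theorem sum_Ioc_mul_card_fiber {ι : Type*} [Fintype ι] (τ : ι → ℕ) (M : ℕ)
    (hτ : ∀ j, τ j ≤ M) (f : ℕ → ℤ) (k : ℕ) :
    ∑ l ∈ Finset.Ioc k M, f l * ((Finset.univ.filter (fun j => τ j = l)).card : ℤ) =
      ∑ j, if k < τ j then f (τ j) else 0 := by
  simp_rw [Finset.card_filter, Nat.cast_sum, Finset.mul_sum]
  rw [Finset.sum_comm]
  refine Finset.sum_congr rfl fun j _ => ?_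
  simp [hτ j]

/-- A sequence equal to one plus a nonnegative combination of its later terms is positive. -/
theorem pos_of_eq_one_add_sum_Ioc (M : ℕ) (H c : ℕ → ℤ) (hc : ∀ l, 0 ≤ c l)
    (hH : ∀ k, 1 ≤ k → k ≤ M → H k = 1 + ∑ l ∈ Finset.Ioc k M, 2 * H l * c l)
    (k : ℕ) (hk : 1 ≤ k) (hkM : k ≤ M) : 0 < H k := by
  rw [hH k hk hkM]
  refine add_pos_of_pos_of_nonneg one_pos (Finset.sum_nonneg fun l hl => ?_)
  rw [Finset.mem_Ioc] at hl
  have hpos := pos_of_eq_one_add_sum_Ioc M H c hc hH l (by omega) hl.2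
  exact mul_nonneg (by omega) (hc l)
termination_by M - k
decreasing_by
  rw [Finset.mem_Ioc] at hl
  omega


/-- Given a tier assignment for the variables of a system of
inequalities with coefficients bounded by 2 in absolute value, such that each
inequality has a positive-coefficient variable whose tier strictly precedes
the tier of every negative-coefficient variable, the recursively defined
heights `h_M = 1`, `h_k = 1 + ∑_{ℓ=k+1}^M 2·h_ℓ·|T_ℓ|` satisfy every
inequality. -/
theorem stmt_6 (m n : ℕ) (α : Fin m → Fin n → ℤ)
    (hbound : ∀ i j, |α i j| ≤ 2)
    (M : ℕ) (τ : Fin n → ℕ) (hτ : ∀ j, 1 ≤ τ j ∧ τ j ≤ M)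
    (hstruct : ∀ i : Fin m, ∃ j : Fin n, 0 < α i j ∧
      ∀ j' : Fin n, α i j' < 0 → τ j < τ j')
    (H : ℕ → ℤ) (hHM : H M = 1)
    (hHrec : ∀ k, 1 ≤ k → k < M →
      H k = 1 + ∑ l ∈ Finset.Ioc k M,
        2 * H l * ((Finset.univ.filter (fun j : Fin n => τ j = l)).card : ℤ)) :
    ∀ i : Fin m, 0 < ∑ j : Fin n, α i j * H (τ j) := by
  have hrec : ∀ k, 1 ≤ k → k ≤ M → H k = 1 + ∑ l ∈ Finset.Ioc k M,
      2 * H l * ((Finset.univ.filter (fun j : Fin n => τ j = l)).card : ℤ) := by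
    intro k hk hkM
    rcases hkM.lt_or_eq with h | rfl
    · exact hHrec k hk h
    · simp [hHM]
  have hpos : ∀ j, 0 < H (τ j) := fun j =>
    pos_of_eq_one_add_sum_Ioc M H _ (fun l => Int.natCast_nonneg _) hrec _ (hτ j).1 (hτ j).2
  intro i
  obtain ⟨p, hp, hneg⟩ := hstruct i
  have hHp := hrec (τ p) (hτ p).1 (hτ p).2
  rw [sum_Ioc_mul_card_fiber τ M (fun j => (hτ j).2) (fun l => 2 * H l)] at hHp
  have hle : ∑ j, ((if j = p then H (τ p) else 0) -
      (if τ p < τ j then 2 * H (τ j) else 0)) ≤ ∑ j, α i j * H (τ j) := by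
    refine Finset.sum_le_sum fun j _ => ?_
    have hj := hpos j
    by_cases hjp : j = p
    · subst hjp
      simp only [if_true, lt_irrefl, if_false]
      nlinarith
    · rw [if_neg hjp]
      split_ifs with hlt
      · nlinarith [(abs_le.mp (hbound i j)).1]
      · have : 0 ≤ α i j := not_lt.mp fun h => hlt (hneg j h)
        nlinarith
  rw [Finset.sum_sub_distrib, Finset.sum_ite_eq' Finset.univ p] at hle
  simp only [Finset.mem_univ, if_true] at hle
  linarith
end
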